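/- arXiv:2510.09992 — 2 statements merged into one kernel-verified Lean document; each statement's English description precedes it below -/
import Mathlib

section
/- Let η : T² → ℝ be twice continuously differentiable with η(x) > 0 for all x ∈ T², and let M > 0 be such that sup_{T²}|η| ≤ M, sup_{T²}|∇η| ≤ M and sup_{T²}‖∇²η‖ ≤ M. Let x₀ ∈ T² be a point at which η attains its minimum value η_min = η(x₀). Then ∫_{T²} 1/η(x) dx ≥ (2π/M)·ln(1 + M/(8 η_min)). -/
open MeasureTheory Real

/-- The fundamental domain `[0,1)²` of the unit torus `T² = (ℝ/ℤ)²`, viewed inside `ℝ²`.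
Functions on the torus are modelled as `1`-periodic functions on `ℝ²`, and integrals over the
torus as integrals over this fundamental domain. -/
def torusCube : Set (EuclideanSpace ℝ (Fin 2)) :=
  {x | ∀ i, x i ∈ Set.Ico (0 : ℝ) 1}

/-- Second-order Taylor upper bound around a critical point of a `C²` function. -/
lemma le_add_sq_of_fderiv_eq_zero {E : Type*} [NormedAddCommGroup E] [NormedSpace ℝ E]
    {f : E → ℝ} (hf : ContDiff ℝ 2 f) {M : ℝ}
    (hhess : ∀ x, ‖fderiv ℝ (fderiv ℝ f) x‖ ≤ M) {x₀ : E} (h₀ : fderiv ℝ f x₀ = 0) (x : E) :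
    f x ≤ f x₀ + M / 2 * ‖x - x₀‖ ^ 2 := by
  have hd : Differentiable ℝ f := hf.differentiable (by norm_num)
  have hd' : Differentiable ℝ (fderiv ℝ f) :=
    (hf.fderiv_right (m := 1) (by norm_num)).differentiable (by norm_num)
  have hlip (y : E) : ‖fderiv ℝ f y‖ ≤ M * ‖y - x₀‖ := by
    simpa [h₀] using convex_univ.norm_image_sub_le_of_norm_fderiv_le
      (fun z _ ↦ hd' z) (fun z _ ↦ hhess z) (Set.mem_univ x₀) (Set.mem_univ y)
  set v := x - x₀ with hv
  have hline (t : ℝ) : HasDerivAt (fun t : ℝ ↦ x₀ + t • v) v t := by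
    simpa using ((hasDerivAt_id t).smul_const v).const_add x₀
  have hderiv (t : ℝ) : HasDerivAt
      (fun t : ℝ ↦ M / 2 * ‖v‖ ^ 2 * t ^ 2 - f (x₀ + t • v))
      (M / 2 * ‖v‖ ^ 2 * (2 * t) - fderiv ℝ f (x₀ + t • v) v) t := by
    have h1 := ((hasDerivAt_id t).pow 2).const_mul (M / 2 * ‖v‖ ^ 2)
    have h2 := (hd (x₀ + t • v)).hasFDerivAt.comp_hasDerivAt t (hline t)
    convert! h1.sub h2 using 1
    simp
  have hmono : MonotoneOn (fun t : ℝ ↦ M / 2 * ‖v‖ ^ 2 * t ^ 2 - f (x₀ + t • v))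
      (Set.Ici 0) := by
    refine monotoneOn_of_deriv_nonneg (convex_Ici 0)
      (fun t _ ↦ (hderiv t).continuousAt.continuousWithinAt)
      (fun t _ ↦ (hderiv t).differentiableAt.differentiableWithinAt) fun t ht ↦ ?_
    rw [interior_Ici, Set.mem_Ioi] at ht
    rw [(hderiv t).deriv, sub_nonneg]
    calc fderiv ℝ f (x₀ + t • v) v
        ≤ ‖fderiv ℝ f (x₀ + t • v)‖ * ‖v‖ :=
          (Real.le_norm_self _).trans (ContinuousLinearMap.le_opNorm _ _)
      _ ≤ M * ‖x₀ + t • v - x₀‖ * ‖v‖ := by gcongr; exact hlip _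
      _ = M / 2 * ‖v‖ ^ 2 * (2 * t) := by
          rw [add_sub_cancel_left, norm_smul, Real.norm_of_nonneg ht.le]; ring
  have := hmono (Set.mem_Ici.2 le_rfl) (Set.mem_Ici.2 zero_le_one) zero_le_one
  simp [hv] at this
  linarith

section Torus

open scoped Pointwise

lemma torusCube_eq_fundamentalDomain :
    torusCube = ZSpan.fundamentalDomain (EuclideanSpace.basisFun (Fin 2) ℝ).toBasis := by
  ext x
  simp [torusCube, ZSpan.mem_fundamentalDomain]

/-- The integral of a periodic function over the unit cube is translation invariant. -/
lemma setIntegral_torusCube_eq_vadd {f : EuclideanSpace ℝ (Fin 2) → ℝ}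
    (hper : ∀ (x : EuclideanSpace ℝ (Fin 2)) (i : Fin 2),
      f (x + EuclideanSpace.single i (1 : ℝ)) = f x) (c : EuclideanSpace ℝ (Fin 2)) :
    ∫ x in torusCube, f x = ∫ x in c +ᵥ torusCube, f x := by
  rw [torusCube_eq_fundamentalDomain]
  set b := (EuclideanSpace.basisFun (Fin 2) ℝ).toBasis
  have : Countable (Submodule.span ℤ (Set.range b)).toAddSubgroup :=
    inferInstanceAs (Countable (Submodule.span ℤ (Set.range b)))
  have hb := ZSpan.isAddFundamentalDomain' b volume
  refine hb.setIntegral_eq (hb.vadd_of_comm c) fun ⟨g, hg⟩ x ↦ ?_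
  change f (g + x) = f x
  rw [Submodule.mem_toAddSubgroup] at hg
  induction hg using Submodule.span_induction generalizing x with
  | mem g hg =>
    obtain ⟨i, rfl⟩ := hg
    simpa [b, add_comm] using hper x i
  | zero => simp
  | add g h _ _ hg hh => rw [add_assoc, hg, hh]
  | smul n g _ hg =>
    have hperiodic : Function.Periodic f g := fun y ↦ by rw [add_comm, hg]
    rw [add_comm]
    exact hperiodic.zsmul n x

lemma Continuous.integrableOn_of_isBounded {f : EuclideanSpace ℝ (Fin 2) → ℝ} (hf : Continuous f)
    {s : Set (EuclideanSpace ℝ (Fin 2))} (hs : Bornology.IsBounded s) : IntegrableOn f s :=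
  (hf.continuousOn.integrableOn_compact hs.isCompact_closure).mono_set subset_closure

lemma isBounded_torusCube : Bornology.IsBounded torusCube :=
  torusCube_eq_fundamentalDomain ▸ ZSpan.fundamentalDomain_isBounded _

/-- The unit cube centred at `x₀` contains the ball of radius `1 / 2` around `x₀`. -/
lemma ball_subset_vadd_torusCube (x₀ : EuclideanSpace ℝ (Fin 2)) :
    Metric.ball x₀ (1 / 2) ⊆ (x₀ - WithLp.toLp 2 fun _ ↦ (1 / 2 : ℝ)) +ᵥ torusCube := by
  intro x hx
  rw [Set.mem_vadd_set_iff_neg_vadd_mem]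
  intro i
  have hi : |x i - x₀ i| < 1 / 2 :=
    (PiLp.norm_apply_le (x - x₀) i).trans_lt (mem_ball_iff_norm.1 hx)
  rw [abs_lt] at hi
  simp only [vadd_eq_add, PiLp.add_apply, PiLp.neg_apply, PiLp.sub_apply, Set.mem_Ico]
  constructor <;> linarith

/-- For a nonnegative continuous function on the torus, the integral over a ball of radius `1 / 2`
is at most the integral over the torus. -/
lemma setIntegral_ball_le_setIntegral_torusCube {f : EuclideanSpace ℝ (Fin 2) → ℝ}
    (hf : Continuous f) (hf₀ : ∀ x, 0 ≤ f x)
    (hper : ∀ (x : EuclideanSpace ℝ (Fin 2)) (i : Fin 2),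
      f (x + EuclideanSpace.single i (1 : ℝ)) = f x) (x₀ : EuclideanSpace ℝ (Fin 2)) :
    ∫ x in Metric.ball x₀ (1 / 2), f x ≤ ∫ x in torusCube, f x := by
  rw [setIntegral_torusCube_eq_vadd hper (x₀ - WithLp.toLp 2 fun _ ↦ (1 / 2 : ℝ))]
  exact setIntegral_mono_set (hf.integrableOn_of_isBounded (isBounded_torusCube.vadd _))
    (.of_forall hf₀) (ball_subset_vadd_torusCube x₀).eventuallyLE

end Torus

lemma integral_ball_inv_quadratic {m M : ℝ} (hm : 0 < m) (hM : 0 < M)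
    (x₀ : EuclideanSpace ℝ (Fin 2)) :
    ∫ x in Metric.ball x₀ (1 / 2), 1 / (m + M / 2 * ‖x - x₀‖ ^ 2) =
      (2 * π / M) * Real.log (1 + M / (8 * m)) := by
  have hden (y : ℝ) : 0 < m + M / 2 * y ^ 2 := by positivity
  have hradial : ∫ y in (0 : ℝ)..(1 / 2), y * (1 / (m + M / 2 * y ^ 2)) =
      1 / M * Real.log (1 + M / (8 * m)) := by
    have hF (y : ℝ) : HasDerivAt (fun y ↦ 1 / M * Real.log (m + M / 2 * y ^ 2))
        (y * (1 / (m + M / 2 * y ^ 2))) y := by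
      have h := ((((hasDerivAt_id y).pow 2).const_mul (M / 2)).const_add m).log (hden y).ne'
      convert! h.const_mul (1 / M) using 1
      simp
      field_simp
    rw [intervalIntegral.integral_eq_sub_of_hasDerivAt (fun y _ ↦ hF y)
      (Continuous.intervalIntegrable
        (continuous_id.mul (continuous_const.div (by fun_prop) fun y ↦ (hden y).ne')) _ _),
      ← mul_sub, ← Real.log_div (hden _).ne' (hden _).ne']
    congr 2
    field_simp
    ring
  set g : ℝ → ℝ := (Set.Iio (1 / 2)).indicator fun y ↦ 1 / (m + M / 2 * y ^ 2) with hg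
  calc ∫ x in Metric.ball x₀ (1 / 2), 1 / (m + M / 2 * ‖x - x₀‖ ^ 2)
      = ∫ x, g ‖x - x₀‖ := by
        rw [← integral_indicator Metric.isOpen_ball.measurableSet]
        refine integral_congr_ae (.of_forall fun x ↦ ?_)
        simp only [hg, Set.indicator, mem_ball_iff_norm, Set.mem_Iio]
    _ = ∫ x : EuclideanSpace ℝ (Fin 2), g ‖x‖ := integral_sub_right_eq_self (fun x ↦ g ‖x‖) x₀
    _ = 2 * (π * ∫ y in Set.Ioi (0 : ℝ), y * g y) := by
        rw [integral_fun_norm_addHaar]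
        simp [measureReal_def, EuclideanSpace.volume_ball_fin_two, pi_nonneg]
    _ = 2 * (π * (1 / M * Real.log (1 + M / (8 * m)))) := by
        rw [← hradial, intervalIntegral.integral_of_le (by norm_num), integral_Ioc_eq_integral_Ioo,
          ← Set.Ioi_inter_Iio, ← setIntegral_indicator measurableSet_Iio]
        congr 2
        refine integral_congr_ae (.of_forall fun y ↦ ?_)
        simp [hg, Set.indicator]
    _ = _ := by ring

/-- Let `η : T² → ℝ` be a positive `C²` function on the unit torus and `M > 0` a bound for `η`,
its gradient, and its Hessian. If `η` attains its minimum `η_min = η x₀` at `x₀`, then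
`∫_{T²} 1/η ≥ (2π/M)·ln(1 + M/(8 η_min))`. -/
theorem inv_l1_lower_bound (η : EuclideanSpace ℝ (Fin 2) → ℝ)
    (hη : ContDiff ℝ 2 η)
    (hper : ∀ (x : EuclideanSpace ℝ (Fin 2)) (i : Fin 2),
      η (x + EuclideanSpace.single i (1 : ℝ)) = η x)
    (hpos : ∀ x, 0 < η x)
    (M : ℝ) (hM : 0 < M)
    (hbd : ∀ x, |η x| ≤ M)
    (hgrad : ∀ x, ‖fderiv ℝ η x‖ ≤ M)
    (hhess : ∀ x, ‖fderiv ℝ (fderiv ℝ η) x‖ ≤ M)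
    (x₀ : EuclideanSpace ℝ (Fin 2)) (hmin : ∀ x, η x₀ ≤ η x) :
    (2 * π / M) * Real.log (1 + M / (8 * η x₀)) ≤ ∫ x in torusCube, 1 / η x := by
  have hcont : Continuous fun x ↦ 1 / η x :=
    continuous_const.div hη.continuous fun x ↦ (hpos x).ne'
  have hcrit : fderiv ℝ η x₀ = 0 :=
    IsLocalMin.fderiv_eq_zero (Filter.Eventually.of_forall hmin)
  have hden (x : EuclideanSpace ℝ (Fin 2)) : 0 < η x₀ + M / 2 * ‖x - x₀‖ ^ 2 :=
    add_pos_of_pos_of_nonneg (hpos x₀) (by positivity)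
  have hcont' : Continuous fun x ↦ 1 / (η x₀ + M / 2 * ‖x - x₀‖ ^ 2) :=
    continuous_const.div (by fun_prop) fun x ↦ (hden x).ne'
  calc (2 * π / M) * Real.log (1 + M / (8 * η x₀))
      = ∫ x in Metric.ball x₀ (1 / 2), 1 / (η x₀ + M / 2 * ‖x - x₀‖ ^ 2) :=
        (integral_ball_inv_quadratic (hpos x₀) hM x₀).symm
    _ ≤ ∫ x in Metric.ball x₀ (1 / 2), 1 / η x :=
        setIntegral_mono (hcont'.integrableOn_of_isBounded Metric.isBounded_ball)
          (hcont.integrableOn_of_isBounded Metric.isBounded_ball) fun x ↦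
          one_div_le_one_div_of_le (hpos x) (le_add_sq_of_fderiv_eq_zero hη hhess hcrit x)
    _ ≤ ∫ x in torusCube, 1 / η x :=
        setIntegral_ball_le_setIntegral_torusCube hcont (fun x ↦ (one_div_pos.2 (hpos x)).le)
          (fun x i ↦ by simp only [hper]) x₀
end

section
/- Let z : T² → ℝ be twice continuously differentiable with z(x) > 0 for all x ∈ T². Then for every x ∈ T², |∂₁z(x)|² ≤ sup_{y ∈ T²} ( |∂₁z(y)|² + z(y)·∂₁₁z(y) ), where ∂₁ denotes the partial derivative in the first coordinate direction and ∂₁₁ the corresponding second derivative. -/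
open MeasureTheory Real

/-- First partial derivative (in the direction of the first coordinate) of a function on `ℝ²`. -/
noncomputable def pd1 (f : EuclideanSpace ℝ (Fin 2) → ℝ) (x : EuclideanSpace ℝ (Fin 2)) : ℝ :=
  fderiv ℝ f x (EuclideanSpace.single 0 (1 : ℝ))

/-- A continuous function on `ℝ²` that is `1`-periodic in each coordinate attains its maximum. -/
theorem exists_forall_le_of_periodic {f : EuclideanSpace ℝ (Fin 2) → ℝ} (hf : Continuous f)
    (hper : ∀ (x : EuclideanSpace ℝ (Fin 2)) (i : Fin 2),
      f (x + EuclideanSpace.single i (1 : ℝ)) = f x) :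
    ∃ y₀, ∀ y, f y ≤ f y₀ := by
  have hcont : Continuous fun v : Fin 2 → ℝ => f (WithLp.toLp 2 v) :=
    hf.comp (PiLp.continuous_toLp 2 _)
  obtain ⟨v₀, -, hv₀⟩ := (isCompact_Icc (a := (0 : Fin 2 → ℝ)) (b := 1)).exists_isMaxOn
    ⟨0, by simp⟩ hcont.continuousOn
  refine ⟨WithLp.toLp 2 v₀, fun y => ?_⟩
  have hsingle (i : Fin 2) : Function.Periodic f (EuclideanSpace.single i (1 : ℝ)) :=
    fun x => hper x i
  have hfract : f (WithLp.toLp 2 fun i => Int.fract (y i)) = f y := by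
    rw [← ((hsingle 0).zsmul ⌊y 0⌋) _, ← ((hsingle 1).zsmul ⌊y 1⌋) _]
    congr 1
    ext i
    fin_cases i <;> simp
  rw [← hfract]
  exact hv₀ ⟨fun i => Int.fract_nonneg _, fun i => (Int.fract_lt_one _).le⟩

theorem pd1_periodic {f : EuclideanSpace ℝ (Fin 2) → ℝ}
    (hper : ∀ (x : EuclideanSpace ℝ (Fin 2)) (i : Fin 2),
      f (x + EuclideanSpace.single i (1 : ℝ)) = f x)
    (x : EuclideanSpace ℝ (Fin 2)) (i : Fin 2) :
    pd1 f (x + EuclideanSpace.single i (1 : ℝ)) = pd1 f x := by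
  unfold pd1
  rw [← fderiv_comp_add_right]
  simp only [hper]

theorem contDiff_pd1 {f : EuclideanSpace ℝ (Fin 2) → ℝ} {n : WithTop ℕ∞}
    (hf : ContDiff ℝ (n + 1) f) : ContDiff ℝ n (pd1 f) :=
  (hf.fderiv_right le_rfl).clm_apply contDiff_const

/-- Let `z : T² → ℝ` be a positive `C²` function on the unit torus (modelled as a `1`-periodic
function on `ℝ²`). Then for every `x`,
`|∂₁z(x)|² ≤ sup_y (|∂₁z(y)|² + z(y)·∂₁₁z(y))`. -/
theorem pd1_sq_le_sup (z : EuclideanSpace ℝ (Fin 2) → ℝ)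
    (hz : ContDiff ℝ 2 z)
    (hper : ∀ (x : EuclideanSpace ℝ (Fin 2)) (i : Fin 2),
      z (x + EuclideanSpace.single i (1 : ℝ)) = z x)
    (hpos : ∀ x, 0 < z x) :
    ∀ x, (pd1 z x) ^ 2 ≤ ⨆ y, ((pd1 z y) ^ 2 + z y * pd1 (pd1 z) y) := by
  intro x
  have hper1 : ∀ (y : EuclideanSpace ℝ (Fin 2)) (i : Fin 2),
      pd1 z (y + EuclideanSpace.single i (1 : ℝ)) = pd1 z y := pd1_periodic hper
  have hC1 : ContDiff ℝ 1 (pd1 z) := contDiff_pd1 (hz.of_le one_add_one_eq_two.le)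
  have hC0 : Continuous (pd1 (pd1 z)) := (contDiff_pd1 (n := 0) (by simpa using hC1)).continuous
  have hbdd : BddAbove (Set.range fun y => (pd1 z y) ^ 2 + z y * pd1 (pd1 z) y) := by
    obtain ⟨y₀, hy₀⟩ := exists_forall_le_of_periodic
      (f := fun y => (pd1 z y) ^ 2 + z y * pd1 (pd1 z) y)
      ((hC1.continuous.pow 2).add (hz.continuous.mul hC0))
      (fun y i => by simp only [hper1, hper, pd1_periodic hper1])
    exact ⟨_, Set.forall_mem_range.2 hy₀⟩
  obtain ⟨y₀, hy₀⟩ := exists_forall_le_of_periodic (f := fun y => (pd1 z y) ^ 2)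
    (hC1.continuous.pow 2) (fun y i => by simp only [hper1])
  have hcrit : pd1 z y₀ * pd1 (pd1 z) y₀ = 0 := by
    have hd := ((hC1.differentiable one_ne_zero) y₀).hasFDerivAt.pow 2
    have h0 := IsLocalMax.hasFDerivAt_eq_zero (Filter.Eventually.of_forall hy₀) hd
    have h1 := DFunLike.congr_fun h0 (EuclideanSpace.single 0 (1 : ℝ))
    simpa [pd1] using h1
  rcases mul_eq_zero.1 hcrit with h | h
  · have hzero : pd1 z = fun _ => 0 := by
      funext y
      have := hy₀ y
      simp only [h] at this
      nlinarith [sq_nonneg (pd1 z y)]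
    refine le_trans (le_of_eq ?_) (le_ciSup hbdd x)
    simp only [hzero]
    simp [pd1]
  · refine (hy₀ x).trans (le_trans (le_of_eq ?_) (le_ciSup hbdd y₀))
    simp [h]
end
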